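/- (Average values are central and factorize, Propositions 4.1 and 4.2.) For each O ∈ {A, B, C, D} and λ ∈ ℂ∖{0}, define the average 𝒪(Λ) = ∏_{k=1}^{p} O(q^k λ), where Λ = λ^p (the factors O(q^kλ) mutually commute). Then each of 𝒜(Λ), ℬ(Λ), 𝒞(Λ), 𝒟(Λ) is a scalar multiple of the identity operator on H, and the 2×2 scalar matrix [[𝒜(Λ), ℬ(Λ)],[𝒞(Λ), 𝒟(Λ)]] equals the matrix product 𝓛_N(Λ)·𝓛_{N−1}(Λ)···𝓛_1(Λ) of the classical 2×2 matrices 𝓛_n(Λ). -/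

import Mathlib

open scoped BigOperators Matrix

noncomputable section

namespace SG

/-- Index set for the Hilbert space `H`: tuples in `(S_p)^N`, with a `p`-th root of
unity `z = q^m` encoded by its exponent `m : ZMod p`, `p = 2*l+1`. -/
abbrev Idx (l N : ℕ) := Fin N → ZMod (2*l+1)

/-- `q` raised to the power of an element of `ZMod (2*l+1)`. -/
def Qp (l : ℕ) (q : ℂ) (j : ZMod (2*l+1)) : ℂ := q ^ j.val

/-- The value `w_lam(q^(2n))` given by the defining product formula. -/
def wAux (l : ℕ) (q lam : ℂ) (n : ℕ) : ℂ :=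
  (∏ r ∈ Finset.range n, (1 + lam * q ^ (2*r+1)) / (lam + q ^ (2*r+1))) *
    ∏ r ∈ Finset.range l, (lam + q ^ (2*r+1)) / (1 + q ^ (2*r+1))

/-- `w lam m` is the value `w_lam(q^m)`; since `p` is odd, `q^m = q^(2n)` with
`n = (l+1)*m mod p`. -/
def w (l : ℕ) (q lam : ℂ) (m : ZMod (2*l+1)) : ℂ :=
  wAux l q lam (((l : ZMod (2*l+1)) + 1) * m).val

/-- The discrete Fourier transform `w̄_lam(q^m) = (1/p) ∑_k (q^m)^k w_lam(q^k)`. -/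
def wbar (l : ℕ) (q lam : ℂ) (m : ZMod (2*l+1)) : ℂ :=
  (1 / (2*(l : ℂ)+1)) * ∑ k : ZMod (2*l+1), Qp l q (m * k) * w l q lam k

/-- Regularity: `mu` avoids the poles `{-q^(2r-1)}` of `w_mu` and `w̄_mu`. -/
def Reg (q mu : ℂ) : Prop := ∀ r : ℕ, mu + q ^ (2*r+1) ≠ 0

/-- `ε = -i q^(-1/2)` with `q^(1/2) := q^(l+1)`. -/
def eps (l : ℕ) (q : ℂ) : ℂ := -Complex.I * (q ^ (l+1))⁻¹

/-- The operator `u_n` (with classical parameter `u n`), acting as multiplication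
by `u n * z_n`. -/
def uop (l : ℕ) {N : ℕ} (q : ℂ) (u : Fin N → ℂ) (n : Fin N) :
    Matrix (Idx l N) (Idx l N) ℂ :=
  Matrix.diagonal fun k => u n * Qp l q (k n)

/-- The inverse of `u_n`. -/
def uopInv (l : ℕ) {N : ℕ} (q : ℂ) (u : Fin N → ℂ) (n : Fin N) :
    Matrix (Idx l N) (Idx l N) ℂ :=
  Matrix.diagonal fun k => (u n)⁻¹ * Qp l q (-(k n))

/-- The operator `v_n` (with classical parameter `v n`): `(v_n ψ)(z) = v n * ψ(..., q⁻¹ z_n, ...)`. -/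
def vop (l : ℕ) {N : ℕ} (v : Fin N → ℂ) (n : Fin N) :
    Matrix (Idx l N) (Idx l N) ℂ :=
  fun k k' => if k' = Function.update k n (k n - 1) then v n else 0

/-- The inverse of `v_n`. -/
def vopInv (l : ℕ) {N : ℕ} (v : Fin N → ℂ) (n : Fin N) :
    Matrix (Idx l N) (Idx l N) ℂ :=
  fun k k' => if k' = Function.update k n (k n + 1) then (v n)⁻¹ else 0

/-- The Lax matrix `L_n(lam)` of the lattice Sine-Gordon model, a `2×2` matrix with
operator entries. -/
def Lax (l : ℕ) {N : ℕ} (q : ℂ) (κ ξ u v : Fin N → ℂ) (lam : ℂ) (n : Fin N) :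
    Matrix (Fin 2) (Fin 2) (Matrix (Idx l N) (Idx l N) ℂ) :=
  (κ n / Complex.I) • !![
    Complex.I • (uop l q u n *
      (((q ^ (l+1))⁻¹ * κ n) • vop l v n + (q ^ (l+1) * (κ n)⁻¹) • vopInv l v n)),
    (lam / ξ n) • vop l v n - (lam / ξ n)⁻¹ • vopInv l v n ;
    (lam / ξ n) • vopInv l v n - (lam / ξ n)⁻¹ • vop l v n,
    Complex.I • (uopInv l q u n *
      ((q ^ (l+1) * (κ n)⁻¹) • vop l v n + ((q ^ (l+1))⁻¹ * κ n) • vopInv l v n))]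

/-- The monodromy matrix `M(lam) = L_N(lam) ⋯ L_1(lam)`. -/
def Mon (l : ℕ) {N : ℕ} (q : ℂ) (κ ξ u v : Fin N → ℂ) (lam : ℂ) :
    Matrix (Fin 2) (Fin 2) (Matrix (Idx l N) (Idx l N) ℂ) :=
  ((List.ofFn fun n : Fin N => Lax l q κ ξ u v lam n).reverse).prod

/-- The transfer matrix `T(lam) = A(lam) + D(lam)`. -/
def Top (l : ℕ) {N : ℕ} (q : ℂ) (κ ξ u v : Fin N → ℂ) (lam : ℂ) :
    Matrix (Idx l N) (Idx l N) ℂ :=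
  Mon l q κ ξ u v lam 0 0 + Mon l q κ ξ u v lam 1 1

/-- The operator `Y(lam)`, defined by its matrix elements. -/
def Yop (l : ℕ) {N : ℕ} [NeZero N] (q : ℂ) (κ ξ : Fin N → ℂ) (lam : ℂ) :
    Matrix (Idx l N) (Idx l N) ℂ :=
  fun k k' => ∏ n : Fin N,
    wbar l q (eps l q * lam / (κ n * ξ n)) (k n - k' n) *
      w l q (eps l q * lam * κ n / ξ n) (k n + k' (n + 1))

/-- Regularity of all the `w`- and `w̄`-factors defining `Y(lam)`. -/
def RegY (l : ℕ) {N : ℕ} (q : ℂ) (κ ξ : Fin N → ℂ) (lam : ℂ) : Prop :=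
  ∀ n : Fin N, Reg q (eps l q * lam / (κ n * ξ n)) ∧ Reg q (eps l q * lam * κ n / ξ n)

/-- The Baxter Q-operator `Q(lam, mu) = Y(lam) · Y(conj mu)†`. -/
def Qop (l : ℕ) {N : ℕ} [NeZero N] (q : ℂ) (κ ξ : Fin N → ℂ) (lam mu : ℂ) :
    Matrix (Idx l N) (Idx l N) ℂ :=
  Yop l q κ ξ lam * (Yop l q κ ξ (starRingEnd ℂ mu))ᴴ

/-- The coefficient function `a_N(lam)` of the Baxter equation. -/
def aN (l : ℕ) {N : ℕ} (q : ℂ) (κ ξ : Fin N → ℂ) (lam : ℂ) : ℂ :=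
  (-Complex.I) ^ N * ∏ r : Fin N,
    κ r / (lam / ξ r) * (1 + Complex.I * (q ^ (l+1))⁻¹ * (lam / ξ r) * κ r) *
      (1 + Complex.I * (q ^ (l+1))⁻¹ * (lam / ξ r) / κ r)

/-- The coefficient function `d_N(lam)` of the Baxter equation. -/
def dN (l : ℕ) {N : ℕ} (q : ℂ) (κ ξ : Fin N → ℂ) (lam : ℂ) : ℂ :=
  Complex.I ^ N * ∏ r : Fin N,
    κ r / (lam / ξ r) * (1 - Complex.I * q ^ (l+1) * (lam / ξ r) * κ r) *
      (1 - Complex.I * q ^ (l+1) * (lam / ξ r) / κ r)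

/-- The Θ-charge `Θ = ∏_{n=1}^N v_n^((-1)^(1+n)) = v_1 v_2⁻¹ v_3 v_4⁻¹ ⋯` (unit parameters). -/
def Theta (l : ℕ) {N : ℕ} : Matrix (Idx l N) (Idx l N) ℂ :=
  (List.ofFn fun n : Fin N =>
    if Even (n : ℕ) then vop l (fun _ : Fin N => (1:ℂ)) n
    else vopInv l (fun _ : Fin N => (1:ℂ)) n).prod

/-- The scalar auxiliary R-matrix on `ℂ² ⊗ ℂ²`. -/
def Rmat (q lam : ℂ) : Matrix (Fin 2 × Fin 2) (Fin 2 × Fin 2) ℂ :=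
  fun a b =>
    if a = b then (if a.1 = a.2 then q * lam - q⁻¹ * lam⁻¹ else lam - lam⁻¹)
    else if a.1 = b.2 ∧ a.2 = b.1 then q - q⁻¹ else 0

/-- The R-matrix with entries viewed as scalar multiples of the identity operator on `H`. -/
def Rop (l N : ℕ) (q lam : ℂ) :
    Matrix (Fin 2 × Fin 2) (Fin 2 × Fin 2) (Matrix (Idx l N) (Idx l N) ℂ) :=
  (Rmat q lam).map fun c => c • (1 : Matrix (Idx l N) (Idx l N) ℂ)

/-- The classical (average) Lax matrix `𝓛_n(Λ)`, a scalar 2×2 matrix, built from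
`K_n = κ_n^p`, `X_n = ξ_n^p`, `U_n = u_n^p`, `V_n = v_n^p`. -/
def Lcl (l : ℕ) {N : ℕ} (κ ξ u v : Fin N → ℂ) (L : ℂ) (n : Fin N) :
    Matrix (Fin 2) (Fin 2) ℂ :=
  (1 / Complex.I ^ (2*l+1)) • !![
    Complex.I ^ (2*l+1) * (u n) ^ (2*l+1) *
      (((κ n) ^ (2*l+1)) ^ 2 * (v n) ^ (2*l+1) + ((v n) ^ (2*l+1))⁻¹),
    (κ n) ^ (2*l+1) * (L * (v n) ^ (2*l+1) / (ξ n) ^ (2*l+1)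
      - (ξ n) ^ (2*l+1) / ((v n) ^ (2*l+1) * L)) ;
    (κ n) ^ (2*l+1) * (L / ((ξ n) ^ (2*l+1) * (v n) ^ (2*l+1))
      - (ξ n) ^ (2*l+1) * (v n) ^ (2*l+1) / L),
    Complex.I ^ (2*l+1) * ((u n) ^ (2*l+1))⁻¹ *
      (((κ n) ^ (2*l+1)) ^ 2 * ((v n) ^ (2*l+1))⁻¹ + (v n) ^ (2*l+1))]

/-- The product `𝓛_N(Λ) 𝓛_{N-1}(Λ) ⋯ 𝓛_1(Λ)` of the classical Lax matrices. -/
def LclProd (l : ℕ) {N : ℕ} (κ ξ u v : Fin N → ℂ) (L : ℂ) : Matrix (Fin 2) (Fin 2) ℂ :=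
  ((List.ofFn fun n : Fin N => Lcl l κ ξ u v L n).reverse).prod

/-- The average `𝒪(Λ) = ∏_{k=1}^{p} O(q^k λ)` of the monodromy matrix entry `M(·) i j`. -/
def avgEntry (l : ℕ) {N : ℕ} (q : ℂ) (κ ξ u v : Fin N → ℂ) (i j : Fin 2) (lam : ℂ) :
    Matrix (Idx l N) (Idx l N) ℂ :=
  (List.ofFn fun k : Fin (2*l+1) => Mon l q κ ξ u v (q ^ ((k : ℕ) + 1) * lam) i j).prod

/-- The kernel matrix `Y_0`, `(Y_0)_{k,k'} = ∏_n q^(-2 k_n (k'_n + k'_{n+1}))`. -/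
def Y0mat (l : ℕ) {N : ℕ} [NeZero N] (q : ℂ) : Matrix (Idx l N) (Idx l N) ℂ :=
  fun k k' => ∏ n : Fin N, Qp l q (-(2 * k n * (k' n + k' (n + 1))))

/-- The kernel matrix `Y_∞`, `(Y_∞)_{k,k'} = ∏_n q^(+2 k_n (k'_n + k'_{n+1}))`. -/
def Yinfmat (l : ℕ) {N : ℕ} [NeZero N] (q : ℂ) : Matrix (Idx l N) (Idx l N) ℂ :=
  fun k k' => ∏ n : Fin N, Qp l q (2 * k n * (k' n + k' (n + 1)))

end SG

open SG

/-! ### Ordered products -/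

/-- Ordered product `f 0 * f 1 * ... * f (n-1)`. -/
def oprod {R : Type*} [Monoid R] (f : ℕ → R) : ℕ → R
  | 0 => 1
  | n+1 => oprod f n * f n

theorem ofFn_prod_eq_oprod {R : Type*} [Monoid R] (f : ℕ → R) (n : ℕ) :
    (List.ofFn fun k : Fin n => f k).prod = oprod f n := by
  induction n with
  | zero => simp [oprod]
  | succ n ih => rw [List.ofFn_succ_last]; simp [oprod, ih]

theorem oprod_front {R : Type*} [Monoid R] (f : ℕ → R) (n : ℕ) :
    oprod f (n+1) = f 0 * oprod (fun k => f (k+1)) n := by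
  induction n with
  | zero => simp [oprod]
  | succ n ih => rw [oprod, ih, oprod, mul_assoc]

theorem oprod_congr {R : Type*} [Monoid R] {f g : ℕ → R} (n : ℕ) (h : ∀ k < n, f k = g k) :
    oprod f n = oprod g n := by
  induction n with
  | zero => rfl
  | succ n ih =>
    rw [oprod, oprod, ih (fun k hk => h k (by omega)), h n (by omega)]

theorem oprod_const {R : Type*} [Monoid R] (a : R) (n : ℕ) :
    oprod (fun _ => a) n = a ^ n := by
  induction n with
  | zero => simp [oprod]
  | succ n ih => rw [oprod, ih, pow_succ]

theorem oprod_smul {R : Type*} [Ring R] [Algebra ℂ R] (c : ℂ) (f : ℕ → R) (n : ℕ) :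
    oprod (fun k => c • f k) n = c ^ n • oprod f n := by
  induction n with
  | zero => simp [oprod]
  | succ n ih => simp only [oprod, ih, pow_succ, smul_mul_smul_comm]

theorem oprod_commute {R : Type*} [Monoid R] (f : ℕ → R) (a : R) (h : ∀ k, Commute a (f k))
    (n : ℕ) : Commute a (oprod f n) := by
  induction n with
  | zero => exact Commute.one_right _
  | succ n ih => exact ih.mul_right (h n)

/-- Sum of all words of length `n` in `a`, `b` with `r` letters `b`. -/
def ews {R : Type*} [Ring R] (a b : ℕ → R) : ℕ → ℕ → R
  | 0, 0 => 1
  | 0, _+1 => 0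
  | n+1, 0 => ews a b n 0 * a n
  | n+1, r+1 => ews a b n (r+1) * a n + ews a b n r * b n

theorem ews_zero {R : Type*} [Ring R] (a b : ℕ → R) (n : ℕ) : ews a b n 0 = oprod a n := by
  induction n with
  | zero => simp [ews, oprod]
  | succ n ih => simp [ews, oprod, ih]

theorem ews_gt {R : Type*} [Ring R] (a b : ℕ → R) (n : ℕ) : ∀ r, n < r → ews a b n r = 0 := by
  induction n with
  | zero => intro r hr; cases r with
    | zero => omega
    | succ r => simp [ews]
  | succ n ih => intro r hr; cases r with
    | zero => omega
    | succ r => simp [ews, ih (r+1) (by omega), ih r (by omega)]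

theorem ews_self {R : Type*} [Ring R] (a b : ℕ → R) (n : ℕ) : ews a b n n = oprod b n := by
  induction n with
  | zero => simp [ews, oprod]
  | succ n ih => simp [ews, oprod, ih, ews_gt a b n (n+1) (by omega)]

/-- The word `d ... d c ... c`. -/
def wd {R : Type*} [Ring R] (c d : ℕ → R) (n r : ℕ) : R :=
  oprod (fun k => if k < r then d k else c k) n

theorem wd_c {R : Type*} [Ring R] (c d : ℕ → R) (n r : ℕ) (h : r ≤ n) :
    wd c d n r * c n = wd c d (n+1) r := by
  simp [wd, oprod, not_lt.mpr h]

theorem wd_zero {R : Type*} [Ring R] (c d : ℕ → R) (n : ℕ) : wd c d n 0 = oprod c n := by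
  simp [wd]

theorem wd_self {R : Type*} [Ring R] (c d : ℕ → R) (n r : ℕ) (h : n ≤ r) :
    wd c d n r = oprod d n :=
  oprod_congr n (fun k hk => by simp [show k < r by omega])

theorem wd_d {R : Type*} [Ring R] (c d : ℕ → R) (hcd : ∀ k, c k * d (k+1) = d k * c (k+1))
    (n : ℕ) : ∀ r, r ≤ n → wd c d n r * d n = wd c d (n+1) (r+1) := by
  induction n with
  | zero => intro r hr; simp [wd, oprod]
  | succ n ih =>
    intro r hr
    rcases Nat.lt_or_ge n r with h | h
    · rw [wd_self _ _ _ _ (by omega), wd_self _ _ _ _ (by omega)]; rfl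
    · rw [← wd_c c d n r h, mul_assoc, hcd, ← mul_assoc, ih r h, wd_c _ _ _ _ (by omega)]

theorem oprod_add {R : Type*} [Ring R] (a b c d : ℕ → R)
    (hcd : ∀ k, c k * d (k+1) = d k * c (k+1))
    (hac : ∀ j k, Commute (a j) (c k)) (had : ∀ j k, Commute (a j) (d k))
    (hbc : ∀ j k, Commute (b j) (c k)) (hbd : ∀ j k, Commute (b j) (d k)) (n : ℕ) :
    oprod (fun k => a k * c k + b k * d k) n
      = ∑ r ∈ Finset.range (n+1), ews a b n r * wd c d n r := by
  have comm : ∀ (x : R), (∀ k, Commute x (c k)) → (∀ k, Commute x (d k)) → ∀ m r,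
      Commute x (wd c d m r) := by
    intro x h1 h2 m r
    apply oprod_commute
    intro k
    split_ifs
    · exact h2 k
    · exact h1 k
  induction n with
  | zero => simp [oprod, ews, wd]
  | succ n ih =>
    rw [oprod, ih, Finset.sum_range_succ' _ (n+1), Finset.sum_mul]
    have e1 : ∀ r ∈ Finset.range (n+1), ews a b n r * wd c d n r * (a n * c n + b n * d n)
        = ews a b n r * a n * wd c d (n+1) r + ews a b n r * b n * wd c d (n+1) (r+1) := by
      intro r hr
      have hr' : r ≤ n := by simpa [Nat.lt_succ_iff] using hr
      rw [← wd_c c d n r hr', ← wd_d c d hcd n r hr', mul_add]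
      congr 1
      · rw [mul_assoc, ← mul_assoc (wd c d n r), ← (comm (a n) (hac n) (had n) n r).eq]
        simp only [mul_assoc]
      · rw [mul_assoc, ← mul_assoc (wd c d n r), ← (comm (b n) (hbc n) (hbd n) n r).eq]
        simp only [mul_assoc]
    rw [Finset.sum_congr rfl e1, Finset.sum_add_distrib]
    have e2 : ∀ r, ews a b (n+1) (r+1) * wd c d (n+1) (r+1) =
      ews a b n (r+1) * a n * wd c d (n+1) (r+1) + ews a b n r * b n * wd c d (n+1) (r+1) := by
      intro r; simp [ews, add_mul]
    simp only [e2, Finset.sum_add_distrib]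
    rw [Finset.sum_range_succ' _ n, Finset.sum_range_succ (fun r => ews a b n (r+1) * a n * _) n,
      ews_gt a b n (n+1) (by omega)]
    simp only [ews, zero_mul, add_zero]
    abel

/-! ### The q-binomial vanishing -/

theorem ews_formula {R : Type*} [Ring R] [Algebra ℂ R] (s : ℤ → ℂ) (α : R) (β : ℤ → R)
    (hs0 : s 0 = 0)
    (hc : ∀ i j, Commute (β i) (β j)) (hsh : ∀ k, β k * α = α * β (k-1))
    (htrig : ∀ n r : ℤ, s (n+1) • β (r+1) = s (n-r) • β 0 + s (r+1) • β (n+1)) (n : ℕ) :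
    ∀ r : ℕ, (∏ j ∈ Finset.range r, s (j+1)) • ews (fun _ => α) (fun k => β (k+1)) n r
      = (∏ j ∈ Finset.range r, s (n-j)) • (α ^ (n-r) * oprod (fun k => β (k+1)) r) := by
  have shp : ∀ r : ℕ, oprod (fun k : ℕ => β (k+1)) r * α = α * oprod (fun k : ℕ => β k) r := by
    intro r
    induction r with
    | zero => simp [oprod]
    | succ r ih =>
      rw [oprod, mul_assoc, hsh, ← mul_assoc, ih, oprod, mul_assoc]; simp
  have fr : ∀ r : ℕ, oprod (fun k : ℕ => β k) (r+1) = oprod (fun k : ℕ => β (k+1)) r * β 0 := by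
    intro r
    rw [oprod_front]
    have := oprod_commute (fun k : ℕ => β (k+1)) (β 0) (fun k => hc _ _) r
    simpa using this.eq
  induction n with
  | zero =>
    intro r
    cases r with
    | zero => simp [ews, oprod]
    | succ r => 
      rw [Finset.prod_range_succ' (fun j : ℕ => s (((0:ℕ):ℤ)-j))]; simp [ews, hs0]
  | succ n ih =>
    intro r
    cases r with
    | zero =>
      have := ih 0
      simp [oprod] at this
      simp [ews, this, oprod, pow_succ]
    | succ r =>
      rw [ews, smul_add, ← smul_mul_assoc, ih (r+1), Finset.prod_range_succ (fun j : ℕ => s (j+1)),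
        mul_comm _ (s (r+1)), mul_smul, ← smul_mul_assoc _ (ews _ _ n r), ih r]
      rw [Finset.prod_range_succ (fun j : ℕ => s ((n:ℤ)-j)),
        Finset.prod_range_succ' (fun j : ℕ => s (((n+1:ℕ):ℤ)-j))]
      have e0 : ∀ j : ℕ, ((n+1:ℕ):ℤ) - ((j+1:ℕ):ℤ) = n - j := by intro j; push_cast; ring
      simp only [e0]
      set P := ∏ j ∈ Finset.range r, s ((n:ℤ)-j) with hP
      rcases Nat.lt_or_ge n r with h | h
      · have : P = 0 := Finset.prod_eq_zero (i := n) (by simpa using h) (by simp [hs0])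
        simp [this]
      · have key : (P * s (n - r)) • (α ^ (n - (r+1)) * oprod (fun k : ℕ => β (k+1)) (r+1)) * α
            = (P * s (n-r)) • (α ^ (n-r) * (oprod (fun k : ℕ => β (k+1)) r * β 0)) := by
          rcases Nat.eq_or_lt_of_le h with h' | h'
          · subst h'; simp [hs0]
          · rw [smul_mul_assoc, mul_assoc, shp, ← mul_assoc, ← pow_succ, fr,
              show n - (r+1) + 1 = n - r by omega]
        rw [key, show n + 1 - (r+1) = n - r by omega]
        have ht := htrig n r
        rw [oprod]
        have : ((n+1:ℕ):ℤ) - ((0:ℕ):ℤ) = n+1 := by push_cast; ring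
        have ht' := congrArg (fun z => P • (α ^ (n-r) * (oprod (fun k : ℕ => β (k+1)) r * z))) ht
        simp only [mul_add, smul_add, mul_smul_comm] at ht'
        rw [this, mul_smul, mul_smul, ht', smul_mul_assoc, mul_assoc]
        congr 1
        rw [smul_comm]

theorem ews_vanish {R : Type*} [Ring R] [Algebra ℂ R] (s : ℤ → ℂ) (α : R) (β : ℤ → R) (p : ℕ)
    (hs0 : s 0 = 0) (hsp : s p = 0) (hs : ∀ j : ℕ, 0 < j → j < p → s j ≠ 0)
    (hc : ∀ i j, Commute (β i) (β j)) (hsh : ∀ k, β k * α = α * β (k-1))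
    (htrig : ∀ n r : ℤ, s (n+1) • β (r+1) = s (n-r) • β 0 + s (r+1) • β (n+1)) 
    (r : ℕ) (h0 : 0 < r) (hr : r < p) :
    ews (fun _ => α) (fun k => β (k+1)) p r = 0 := by
  have h := ews_formula s α β hs0 hc hsh htrig p r
  have z : (∏ j ∈ Finset.range r, s ((p:ℤ)-j)) = 0 :=
    Finset.prod_eq_zero (i := 0) (by simpa using h0) (by simpa using hsp)
  rw [z, zero_smul] at h
  refine (smul_eq_zero.mp h).resolve_left ?_
  refine Finset.prod_ne_zero_iff.mpr fun j hj => ?_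
  have := hs (j+1) (by omega) (by simp at hj; omega)
  simpa using this

theorem oprod_split {R : Type*} [Ring R] [Algebra ℂ R] (s : ℤ → ℂ) (α : R) (β : ℤ → R) (p : ℕ)
    (hp : 0 < p)
    (hs0 : s 0 = 0) (hsp : s p = 0) (hs : ∀ j : ℕ, 0 < j → j < p → s j ≠ 0)
    (hc : ∀ i j, Commute (β i) (β j)) (hsh : ∀ k, β k * α = α * β (k-1))
    (htrig : ∀ n r : ℤ, s (n+1) • β (r+1) = s (n-r) • β 0 + s (r+1) • β (n+1)) 
    (c d : ℕ → R)
    (hcd : ∀ k, c k * d (k+1) = d k * c (k+1))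
    (hac : ∀ k, Commute α (c k)) (had : ∀ k, Commute α (d k))
    (hbc : ∀ j k, Commute (β j) (c k)) (hbd : ∀ j k, Commute (β j) (d k)) :
    oprod (fun k : ℕ => α * c k + β (k+1) * d k) p
      = α ^ p * oprod c p + oprod (fun k : ℕ => β (k+1)) p * oprod d p := by
  obtain ⟨m, rfl⟩ : ∃ m, p = m+1 := ⟨p-1, by omega⟩
  rw [oprod_add (fun _ => α) (fun k : ℕ => β (k+1)) c d hcd (fun _ => hac) (fun _ => had)
    (fun _ => hbc _) (fun _ => hbd _), Finset.sum_range_succ, Finset.sum_range_succ',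
    Finset.sum_eq_zero]
  · rw [ews_zero, ews_self, wd_zero, wd_self _ _ _ _ le_rfl, oprod_const]; simp
  · intro r hr
    rw [ews_vanish s α β (m+1) hs0 hsp hs hc hsh htrig (r+1) (by omega) (by simp at hr; omega)]
    simp

/-! ### Products over all roots of unity -/

theorem prod_roots_comm {K : Type*} [CommRing K] [IsDomain K] [Algebra ℂ K] (l : ℕ) (q : ℂ)
    (hq : IsPrimitiveRoot q (2*l+1)) (x y : K) :
    ∏ k ∈ Finset.range (2*l+1), (q ^ k • x - (q ^ k)⁻¹ • y) = x ^ (2*l+1) - y ^ (2*l+1) := by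
  have hq0 : q ≠ 0 := hq.ne_zero (by omega)
  have h2 : IsPrimitiveRoot (q⁻¹ ^ 2) (2*l+1) :=
    hq.inv.pow_of_coprime 2 (by simp)
  have h3 : IsPrimitiveRoot (algebraMap ℂ K (q⁻¹ ^ 2)) (2*l+1) :=
    h2.map_of_injective (algebraMap ℂ K).injective
  rw [h3.pow_sub_pow_eq_prod_sub_mul x y (by omega)]
  have e : ∏ ζ ∈ Polynomial.nthRootsFinset (2*l+1) (1:K), (x - ζ * y)
      = ∏ k ∈ Finset.range (2*l+1), (x - (algebraMap ℂ K (q⁻¹ ^ 2)) ^ k * y) := by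
    symm
    refine Finset.prod_nbij (fun k => (algebraMap ℂ K (q⁻¹ ^ 2)) ^ k) ?_ ?_ ?_ ?_
    · intro k _
      rw [Polynomial.mem_nthRootsFinset (by omega), ← pow_mul, mul_comm, pow_mul, h3.pow_eq_one,
        one_pow]
    · intro a ha b hb hab
      exact h3.pow_inj (by simpa using ha) (by simpa using hb) hab
    · intro z hz
      have hz' : z ^ (2*l+1) = 1 := by
        simpa [Polynomial.mem_nthRootsFinset (show 0 < 2*l+1 by omega)] using hz
      obtain ⟨i, hi, h⟩ := h3.eq_pow_of_pow_eq_one hz'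
      exact ⟨i, by simpa using hi, h⟩
    · intro _ _; rfl
  rw [e]
  have e2 : ∀ k, q ^ k • x - (q ^ k)⁻¹ • y
      = algebraMap ℂ K (q ^ k) * (x - (algebraMap ℂ K (q⁻¹ ^ 2)) ^ k * y) := by
    intro k
    rw [mul_sub, ← mul_assoc, ← map_pow, ← map_mul, Algebra.smul_def, Algebra.smul_def]
    congr 3
    rw [← inv_pow, ← pow_mul, mul_comm 2 k, pow_mul, pow_two, ← mul_assoc, ← mul_pow,
      mul_inv_cancel₀ hq0, one_pow, one_mul]
  simp only [e2]
  rw [Finset.prod_mul_distrib, ← map_prod, Finset.prod_pow_eq_pow_sum, Finset.sum_range_id]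
  have : (2*l+1) * (2*l+1-1) / 2 = (2*l+1) * l := by
    rw [show 2*l+1-1 = l*2 by omega, ← mul_assoc]; simp
  rw [this, pow_mul, hq.pow_eq_one]; simp

theorem oprod_map {R S : Type*} [Ring R] [Ring S] (φ : R →+* S) (f : ℕ → R) (n : ℕ) :
    φ (oprod f n) = oprod (fun k => φ (f k)) n := by
  induction n with
  | zero => simp [oprod]
  | succ n ih => simp [oprod, ih]

theorem oprod_eq_prod {R : Type*} [CommRing R] (f : ℕ → R) (n : ℕ) :
    oprod f n = ∏ k ∈ Finset.range n, f k := by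
  induction n with
  | zero => simp [oprod]
  | succ n ih => simp [oprod, ih, Finset.prod_range_succ]

open Polynomial in
theorem oprod_roots0 {R : Type*} [Ring R] [Algebra ℂ R] (l : ℕ) (q : ℂ)
    (hq : IsPrimitiveRoot q (2*l+1)) (x y : R) (hxy : Commute x y) :
    oprod (fun k => q ^ k • x - (q ^ k)⁻¹ • y) (2*l+1) = x ^ (2*l+1) - y ^ (2*l+1) := by
  have hc : ∀ a : ℂ[X], Commute ((aeval x).toRingHom a) y := by
    intro a
    induction a using Polynomial.induction_on' with
    | add p q hp hq => simpa using Commute.add_left hp hq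
    | monomial n a =>
      simp only [AlgHom.toRingHom_eq_coe, RingHom.coe_coe, aeval_monomial]
      exact (show Commute _ _ from Algebra.commutes a y).mul_left (hxy.pow_left n)
  let φ := eval₂RingHom' (aeval x).toRingHom y hc
  have hX : φ (C X) = x := by simp [φ, eval₂RingHom']
  have hY : φ X = y := by simp [φ, eval₂RingHom']
  have hs : ∀ (a : ℂ) (P : ℂ[X][X]), φ (a • P) = a • φ P := by
    intro a P
    rw [Algebra.smul_def, map_mul, Algebra.smul_def]
    congr 1
    rw [Polynomial.algebraMap_apply]
    simp [φ, eval₂RingHom']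
  have h := congrArg φ (prod_roots_comm (K := ℂ[X][X]) l q hq (C X) X)
  rw [← oprod_eq_prod, oprod_map] at h
  simp only [map_sub, hs, hX, hY, map_pow] at h
  exact h

theorem oprod_roots {R : Type*} [Ring R] [Algebra ℂ R] (l : ℕ) (q : ℂ)
    (hq : IsPrimitiveRoot q (2*l+1)) (x y : R) (hxy : Commute x y) :
    oprod (fun k => q ^ (k+1) • x - (q ^ (k+1))⁻¹ • y) (2*l+1) = x ^ (2*l+1) - y ^ (2*l+1) := by
  have h := oprod_roots0 l q hq (q • x) (q⁻¹ • y) ((hxy.smul_left _).smul_right _)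
  rw [smul_pow, smul_pow, inv_pow, hq.pow_eq_one] at h
  simp only [smul_smul, ← pow_succ, ← mul_inv, inv_one, one_smul] at h
  exact h

/-- The `p`-th power of `u (x + y)`. -/
theorem pow_ufv {R : Type*} [Ring R] [Algebra ℂ R] (l : ℕ) (q : ℂ)
    (hq : IsPrimitiveRoot q (2*l+1)) (u x y : R) (hxy : Commute x y)
    (hx : u * x = q • (x * u)) (hy : u * y = q⁻¹ • (y * u)) :
    (u * (x + y)) ^ (2*l+1) = (x ^ (2*l+1) + y ^ (2*l+1)) * u ^ (2*l+1) := by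
  have hxn : ∀ n : ℕ, u ^ n * x = q ^ n • (x * u ^ n) := by
    intro n
    induction n with
    | zero => simp
    | succ n ih =>
      rw [pow_succ, mul_assoc, hx, mul_smul_comm, ← mul_assoc, ih, smul_mul_assoc, smul_smul,
        mul_assoc, mul_comm q, ← pow_succ]
  have hyn : ∀ n : ℕ, u ^ n * y = (q ^ n)⁻¹ • (y * u ^ n) := by
    intro n
    induction n with
    | zero => simp
    | succ n ih =>
      rw [pow_succ, mul_assoc, hy, mul_smul_comm, ← mul_assoc, ih, smul_mul_assoc, smul_smul,
        mul_assoc, ← mul_inv, mul_comm q, ← pow_succ]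
  have key : ∀ n : ℕ, (u * (x + y)) ^ n
      = oprod (fun k => q ^ (k+1) • x - (q ^ (k+1))⁻¹ • (-y)) n * u ^ n := by
    intro n
    induction n with
    | zero => simp [oprod]
    | succ n ih =>
      rw [pow_succ, ih, oprod, mul_assoc, ← mul_assoc (u ^ n), ← pow_succ, mul_add, hxn, hyn,
        mul_assoc]
      simp [add_mul]
  rw [key, oprod_roots l q hq x (-y) hxy.neg_right, Odd.neg_pow ⟨l, rfl⟩, sub_neg_eq_add]

/-- Splitting lemma specialised to `β_k = q^k x - q^{-k} y`. -/
theorem oprod_split2 {R : Type*} [Ring R] [Algebra ℂ R] (l : ℕ) (q : ℂ)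
    (hq : IsPrimitiveRoot q (2*l+1)) (α x y : R) (hxy : Commute x y)
    (hx : x * α = q⁻¹ • (α * x)) (hy : y * α = q • (α * y))
    (c d : ℕ → R)
    (hcd : ∀ k, c k * d (k+1) = d k * c (k+1))
    (hac : ∀ k, Commute α (c k)) (had : ∀ k, Commute α (d k))
    (hxc : ∀ k, Commute x (c k)) (hxd : ∀ k, Commute x (d k))
    (hyc : ∀ k, Commute y (c k)) (hyd : ∀ k, Commute y (d k)) :
    oprod (fun k : ℕ => α * c k + (q ^ (k+1) • x - (q ^ (k+1))⁻¹ • y) * d k) (2*l+1)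
      = α ^ (2*l+1) * oprod c (2*l+1)
        + (x ^ (2*l+1) - y ^ (2*l+1)) * oprod d (2*l+1) := by
  have hq0 : q ≠ 0 := hq.ne_zero (by omega)
  have h := oprod_split (fun j : ℤ => q ^ j - (q ^ j)⁻¹) α
    (fun j : ℤ => q ^ j • x - (q ^ j)⁻¹ • y) (2*l+1) (by omega) (by simp) ?_ ?_ ?_ ?_ ?_
    c d hcd hac had ?_ ?_
  · rw [← oprod_roots l q hq x y hxy]
    exact_mod_cast h
  · have := hq.pow_eq_one
    have : q ^ ((2*l+1 : ℕ) : ℤ) = 1 := by exact_mod_cast this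
    rw [this]; simp
  · intro j hj hjp h0
    rw [sub_eq_zero, zpow_natCast] at h0
    have h1 : q ^ (j * 2) = 1 := by
      rw [pow_mul, sq]; nth_rewrite 1 [h0]; exact inv_mul_cancel₀ (pow_ne_zero _ hq0)
    have h2 := (hq.dvd_of_pow_eq_one _ h1)
    have h3 : 2*l+1 ∣ j := Nat.Coprime.dvd_of_dvd_mul_right (by simp) h2
    exact absurd (Nat.le_of_dvd hj h3) (by omega)
  · intro i j
    apply Commute.sub_left <;> apply Commute.sub_right <;>
      apply Commute.smul_left <;> apply Commute.smul_right
    · exact Commute.refl _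
    · exact hxy
    · exact hxy.symm
    · exact Commute.refl _
  · intro k
    simp only [sub_mul, mul_sub, smul_mul_assoc, mul_smul_comm, hx, hy, smul_smul]
    congr 2
    · rw [zpow_sub_one₀ hq0]
    · rw [zpow_sub_one₀ hq0, mul_inv, inv_inv]
  · intro n r
    have e1 : q ^ (n - r) = q ^ n * (q ^ r)⁻¹ := by rw [zpow_sub₀ hq0]; rfl
    have e2 : ∀ n : ℤ, q ^ (n + 1) = q ^ n * q := fun n => zpow_add_one₀ hq0 n
    have a1 : q ^ n ≠ 0 := zpow_ne_zero _ hq0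
    have a2 : q ^ r ≠ 0 := zpow_ne_zero _ hq0
    simp only [e1, e2, zpow_zero]
    generalize q ^ n = a at *
    generalize q ^ r = b at *
    match_scalars <;> field_simp <;> ring
  · intro j k
    exact ((hxc k).smul_left _).sub_left ((hyc k).smul_left _)
  · intro j k
    exact ((hxd k).smul_left _).sub_left ((hyd k).smul_left _)

/-! ### The abstract one-site Lax matrix -/

/-- Weyl algebra relations of one site. -/
structure Site {R : Type*} [Ring R] [Algebra ℂ R] (q : ℂ) (u ui v vi : R) : Prop where
  vvi : v * vi = 1
  viv : vi * v = 1
  uui : u * ui = 1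
  uiu : ui * u = 1
  uv : u * v = q • (v * u)
  uvi : u * vi = q⁻¹ • (vi * u)
  uiv : ui * v = q⁻¹ • (v * ui)
  uivi : ui * vi = q • (vi * ui)

/-- Abstract Lax matrix; `h` stands for the square root of `q`. -/
def LaxG {R : Type*} [Ring R] [Algebra ℂ R] (h κ ξ : ℂ) (u ui v vi : R) (lam : ℂ) :
    Matrix (Fin 2) (Fin 2) R :=
  (κ / Complex.I) • !![
    Complex.I • (u * ((h⁻¹ * κ) • v + (h * κ⁻¹) • vi)),
    (lam / ξ) • v - (lam / ξ)⁻¹ • vi ;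
    (lam / ξ) • vi - (lam / ξ)⁻¹ • v,
    Complex.I • (ui * ((h * κ⁻¹) • v + (h⁻¹ * κ) • vi))]

theorem LaxG00 {R : Type*} [Ring R] [Algebra ℂ R] (h κ ξ : ℂ) (u ui v vi : R) (lam : ℂ) :
    LaxG h κ ξ u ui v vi lam 0 0 = κ • (u * ((h⁻¹ * κ) • v + (h * κ⁻¹) • vi)) := by
  simp [LaxG, smul_smul, div_mul_cancel₀, -Complex.div_I]

theorem LaxG01 {R : Type*} [Ring R] [Algebra ℂ R] (h κ ξ : ℂ) (u ui v vi : R) (lam : ℂ) :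
    LaxG h κ ξ u ui v vi lam 0 1
      = (κ / Complex.I) • ((lam / ξ) • v - (lam / ξ)⁻¹ • vi) := rfl

theorem LaxG10 {R : Type*} [Ring R] [Algebra ℂ R] (h κ ξ : ℂ) (u ui v vi : R) (lam : ℂ) :
    LaxG h κ ξ u ui v vi lam 1 0
      = (κ / Complex.I) • ((lam / ξ) • vi - (lam / ξ)⁻¹ • v) := rfl

theorem LaxG11 {R : Type*} [Ring R] [Algebra ℂ R] (h κ ξ : ℂ) (u ui v vi : R) (lam : ℂ) :
    LaxG h κ ξ u ui v vi lam 1 1 = κ • (ui * ((h * κ⁻¹) • v + (h⁻¹ * κ) • vi)) := by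
  simp [LaxG, smul_smul, div_mul_cancel₀, -Complex.div_I]

/-- The degenerate-point Yang-Baxter relations. -/
def YBRel {R : Type*} [Ring R] (M M' : Matrix (Fin 2) (Fin 2) R) : Prop :=
  M 0 0 * M' 1 0 = M 1 0 * M' 0 0 ∧ M 0 1 * M' 1 1 = M 1 1 * M' 0 1 ∧
    M 0 0 * M' 1 1 + M 0 1 * M' 1 0 = M 1 0 * M' 0 1 + M 1 1 * M' 0 0

theorem YBRel_one {R : Type*} [Ring R] : YBRel (1 : Matrix (Fin 2) (Fin 2) R) 1 := by
  simp [YBRel]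

theorem YBRel_mul {R : Type*} [Ring R] {L L' M M' : Matrix (Fin 2) (Fin 2) R}
    (hL : YBRel L L') (hM : YBRel M M')
    (hc : ∀ i j i' j', Commute (M i j) (L' i' j')) : YBRel (L * M) (L' * M') := by
  obtain ⟨l1, l2, l3⟩ := hL
  obtain ⟨m1, m2, m3⟩ := hM
  have e : ∀ (x y : R) i j i' j', x * M i j * (L' i' j' * y) = x * L' i' j' * (M i j * y) := by
    intro x y i j i' j'
    rw [mul_assoc, ← mul_assoc (M i j), (hc i j i' j').eq]; simp only [mul_assoc]
  refine ⟨?_, ?_, ?_⟩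
  · simp only [Matrix.mul_apply, Fin.sum_univ_two, add_mul, mul_add, e]
    rw [l1, l2, m1]
    have := congrArg (· * (M 1 0 * M' 0 0)) l3
    simp only [add_mul] at this
    linear_combination (norm := abel) this
  · simp only [Matrix.mul_apply, Fin.sum_univ_two, add_mul, mul_add, e]
    rw [l1, l2, m2]
    have := congrArg (· * (M 1 1 * M' 0 1)) l3
    simp only [add_mul] at this
    linear_combination (norm := abel) this
  · simp only [Matrix.mul_apply, Fin.sum_univ_two, add_mul, mul_add, e]
    rw [l1, l2]
    have h1 := congrArg (· * (M 1 0 * M' 0 1 + M 1 1 * M' 0 0)) l3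
    have h2 := congrArg (L 0 0 * L' 1 1 * ·) m3
    have h3 := congrArg (L 1 0 * L' 0 1 * ·) m3
    simp only [add_mul, mul_add] at h1 h2 h3
    linear_combination (norm := abel) h1 + h2 - h3

theorem YBRel_LaxG {R : Type*} [Ring R] [Algebra ℂ R] {q h κ ξ : ℂ} {u ui v vi : R} (lam : ℂ)
    (S : Site q u ui v vi) (hh : h ^ 2 = q) (hh0 : h ≠ 0) (hκ : κ ≠ 0) (hξ : ξ ≠ 0)
    (hlam : lam ≠ 0) :
    YBRel (LaxG h κ ξ u ui v vi lam) (LaxG h κ ξ u ui v vi (q * lam)) := by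
  subst hh
  obtain ⟨vvi, viv, uui, uiu, uv, uvi, uiv, uivi⟩ := S
  have vu : ∀ X, v * (u * X) = (h^2)⁻¹ • (u * (v * X)) := by
    intro X; rw [← mul_assoc u, uv, smul_mul_assoc, smul_smul, inv_mul_cancel₀ (by positivity),
      one_smul, mul_assoc]
  have viu : ∀ X, vi * (u * X) = (h^2) • (u * (vi * X)) := by
    intro X; rw [← mul_assoc u, uvi, smul_mul_assoc, smul_smul, mul_inv_cancel₀ (by positivity),
      one_smul, mul_assoc]
  have vui : ∀ X, v * (ui * X) = (h^2) • (ui * (v * X)) := by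
    intro X; rw [← mul_assoc ui, uiv, smul_mul_assoc, smul_smul, mul_inv_cancel₀ (by positivity),
      one_smul, mul_assoc]
  have viui : ∀ X, vi * (ui * X) = (h^2)⁻¹ • (ui * (vi * X)) := by
    intro X; rw [← mul_assoc ui, uivi, smul_mul_assoc, smul_smul, inv_mul_cancel₀ (by positivity),
      one_smul, mul_assoc]
  have uui' : ∀ X, u * (ui * X) = X := by intro X; rw [← mul_assoc, uui, one_mul]
  have uiu' : ∀ X, ui * (u * X) = X := by intro X; rw [← mul_assoc, uiu, one_mul]
  have he : (κ / Complex.I) * (κ / Complex.I) = - κ^2 := by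
    rw [div_mul_div_comm, Complex.I_mul_I]; ring
  refine ⟨?_, ?_, ?_⟩
  · rw [LaxG00, LaxG10, LaxG10, LaxG00]
    simp only [mul_add, add_mul, mul_sub, sub_mul, smul_mul_assoc, mul_smul_comm, mul_assoc,
      vu, viu, vvi, viv, smul_add, smul_sub, smul_smul]
    match_scalars <;> field_simp <;> ring
  · rw [LaxG01, LaxG11, LaxG11, LaxG01]
    simp only [mul_add, add_mul, mul_sub, sub_mul, smul_mul_assoc, mul_smul_comm, mul_assoc,
      vui, viui, vvi, viv, smul_add, smul_sub, smul_smul]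
    match_scalars <;> field_simp <;> ring
  · rw [LaxG01, LaxG11, LaxG11, LaxG01, LaxG00, LaxG00, LaxG10, LaxG10]
    simp only [smul_mul_smul_comm, he]
    simp only [mul_add, add_mul, mul_sub, sub_mul, smul_mul_assoc, mul_smul_comm, mul_assoc,
      vui, viui, vu, viu, uui', uiu', vvi, viv, smul_add, smul_sub, smul_smul]
    match_scalars <;> field_simp <;> ring

/-- Abstract classical Lax matrix. -/
def LclG (l : ℕ) (κ ξ u v L : ℂ) : Matrix (Fin 2) (Fin 2) ℂ :=
  (1 / Complex.I ^ (2*l+1)) • !![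
    Complex.I ^ (2*l+1) * u ^ (2*l+1) *
      ((κ ^ (2*l+1)) ^ 2 * v ^ (2*l+1) + (v ^ (2*l+1))⁻¹),
    κ ^ (2*l+1) * (L * v ^ (2*l+1) / ξ ^ (2*l+1) - ξ ^ (2*l+1) / (v ^ (2*l+1) * L)) ;
    κ ^ (2*l+1) * (L / (ξ ^ (2*l+1) * v ^ (2*l+1)) - ξ ^ (2*l+1) * v ^ (2*l+1) / L),
    Complex.I ^ (2*l+1) * (u ^ (2*l+1))⁻¹ *
      ((κ ^ (2*l+1)) ^ 2 * (v ^ (2*l+1))⁻¹ + v ^ (2*l+1))]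

/-- One-step factorisation of the averages. -/
theorem avg_step {R : Type*} [Ring R] [Algebra ℂ R] {q κ ξ : ℂ} {u ui v vi : R} (l : ℕ)
    (uu vv lam : ℂ) (hq : IsPrimitiveRoot q (2*l+1))
    (S : Site q u ui v vi) (hκ : κ ≠ 0) (hξ : ξ ≠ 0)
    (hlam : lam ≠ 0) (huu : uu ≠ 0) (hvv : vv ≠ 0)
    (up : u ^ (2*l+1) = uu ^ (2*l+1) • 1) (uip : ui ^ (2*l+1) = (uu ^ (2*l+1))⁻¹ • 1)
    (vp : v ^ (2*l+1) = vv ^ (2*l+1) • 1) (vip : vi ^ (2*l+1) = (vv ^ (2*l+1))⁻¹ • 1)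
    (M : ℕ → Matrix (Fin 2) (Fin 2) R) (hM : ∀ k, YBRel (M k) (M (k+1)))
    (cu : ∀ k i j, Commute u (M k i j)) (cui : ∀ k i j, Commute ui (M k i j))
    (cv : ∀ k i j, Commute v (M k i j)) (cvi : ∀ k i j, Commute vi (M k i j)) (i j : Fin 2) :
    oprod (fun k => (LaxG (q^(l+1)) κ ξ u ui v vi (q^(k+1) * lam) * M k) i j) (2*l+1)
      = LclG l κ ξ uu vv (lam ^ (2*l+1)) i 0 • oprod (fun k => M k 0 j) (2*l+1)
        + LclG l κ ξ uu vv (lam ^ (2*l+1)) i 1 • oprod (fun k => M k 1 j) (2*l+1) := by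
  have hq0 : q ≠ 0 := hq.ne_zero (by omega)
  have hh0 : q^(l+1) ≠ 0 := pow_ne_zero _ hq0
  have hhp : (q^(l+1))^(2*l+1) = 1 := by rw [← pow_mul, mul_comm, pow_mul, hq.pow_eq_one, one_pow]
  have vvi' : Commute v vi := by rw [Commute, SemiconjBy, S.vvi, S.viv]
  have hI : (Complex.I)^(2*l+1) ≠ 0 := pow_ne_zero _ Complex.I_ne_zero
  obtain ⟨vvi, viv, uui, uiu, uv, uvi, uiv, uivi⟩ := S
  generalize q^(l+1) = h at *
  have vu : v * u = q⁻¹ • (u * v) := by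
    rw [uv, smul_smul, inv_mul_cancel₀ hq0, one_smul]
  have viu : vi * u = q • (u * vi) := by
    rw [uvi, smul_smul, mul_inv_cancel₀ hq0, one_smul]
  have vui : v * ui = q • (ui * v) := by
    rw [uiv, smul_smul, mul_inv_cancel₀ hq0, one_smul]
  have viui : vi * ui = q⁻¹ • (ui * vi) := by
    rw [uivi, smul_smul, inv_mul_cancel₀ hq0, one_smul]
  have hcol : ∀ k, M k 0 j * M (k+1) 1 j = M k 1 j * M (k+1) 0 j := by
    intro k
    obtain ⟨m1, m2, _⟩ := hM k
    fin_cases j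
    · exact m1
    · exact m2
  have hf : ∀ a b : ℂ, ∀ k i j, Commute (a • v + b • vi) (M k i j) := fun a b k i j =>
    ((cv k i j).smul_left _).add_left ((cvi k i j).smul_left _)
  fin_cases i
  · simp only [Matrix.mul_apply, Fin.sum_univ_two, Fin.zero_eta, LaxG00, LaxG01]
    have key := oprod_split2 l q hq (κ • (u * ((h⁻¹ * κ) • v + (h * κ⁻¹) • vi)))
      ((κ / Complex.I * (lam / ξ)) • v) ((κ / Complex.I * (lam / ξ)⁻¹) • vi)
      ((vvi'.smul_left _).smul_right _) ?_ ?_ (fun k => M k 0 j) (fun k => M k 1 j) hcol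
      (fun k => (((cu k _ _).mul_left (hf _ _ k _ _)).smul_left _))
      (fun k => (((cu k _ _).mul_left (hf _ _ k _ _)).smul_left _))
      (fun k => (cv k _ _).smul_left _) (fun k => (cv k _ _).smul_left _)
      (fun k => (cvi k _ _).smul_left _) (fun k => (cvi k _ _).smul_left _)
    · have e1 : ∀ k, (κ / Complex.I) • ((q ^ (k+1) * lam / ξ) • v - (q ^ (k+1) * lam / ξ)⁻¹ • vi)
          = q ^ (k+1) • ((κ / Complex.I * (lam / ξ)) • v)
            - (q ^ (k+1))⁻¹ • ((κ / Complex.I * (lam / ξ)⁻¹) • vi) := by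
        intro k
        simp only [smul_sub, smul_smul]
        congr 2
        · ring
        · rw [mul_div_assoc, mul_inv]; ring
      simp only [e1]
      rw [key, smul_pow, pow_ufv l q hq u _ _ ((vvi'.smul_left _).smul_right _)]
      · simp only [smul_pow, up, vp, vip]
        simp only [smul_smul, ← sub_smul, ← add_smul, smul_mul_assoc, one_mul]
        congr 2
        · simp [LclG, mul_pow, hhp, inv_pow]
          field_simp
        · simp [LclG, mul_pow, div_pow, inv_pow, -Complex.div_I]
          field_simp
      · rw [mul_smul_comm, uv, smul_mul_assoc, smul_comm]
      · rw [mul_smul_comm, uvi, smul_mul_assoc, smul_comm]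
    · simp only [smul_mul_assoc, mul_smul_comm, ← mul_assoc, vu]
      simp only [mul_add, smul_mul_assoc, mul_smul_comm, mul_assoc, vvi, viv, smul_add, add_mul]
      match_scalars <;> ring
    · simp only [smul_mul_assoc, mul_smul_comm, ← mul_assoc, viu]
      simp only [mul_add, smul_mul_assoc, mul_smul_comm, mul_assoc, vvi, viv, smul_add, add_mul]
      match_scalars <;> ring
  · simp only [Matrix.mul_apply, Fin.sum_univ_two, Fin.mk_one, LaxG10, LaxG11]
    have key := oprod_split2 l q hq (κ • (ui * ((h * κ⁻¹) • v + (h⁻¹ * κ) • vi)))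
      ((κ / Complex.I * (lam / ξ)) • vi) ((κ / Complex.I * (lam / ξ)⁻¹) • v)
      ((vvi'.symm.smul_left _).smul_right _) ?_ ?_ (fun k => M k 1 j) (fun k => M k 0 j)
      (fun k => (hcol k).symm)
      (fun k => (((cui k _ _).mul_left (hf _ _ k _ _)).smul_left _))
      (fun k => (((cui k _ _).mul_left (hf _ _ k _ _)).smul_left _))
      (fun k => (cvi k _ _).smul_left _) (fun k => (cvi k _ _).smul_left _)
      (fun k => (cv k _ _).smul_left _) (fun k => (cv k _ _).smul_left _)
    · have e1 : ∀ k, (κ / Complex.I) • ((q ^ (k+1) * lam / ξ) • vi - (q ^ (k+1) * lam / ξ)⁻¹ • v)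
          = q ^ (k+1) • ((κ / Complex.I * (lam / ξ)) • vi)
            - (q ^ (k+1))⁻¹ • ((κ / Complex.I * (lam / ξ)⁻¹) • v) := by
        intro k
        simp only [smul_sub, smul_smul]
        congr 2
        · ring
        · rw [mul_div_assoc, mul_inv]; ring
      simp only [e1]
      simp only [add_comm (_ * M _ 0 j) (_ * M _ 1 j)]
      rw [key, smul_pow, add_comm ((h * κ⁻¹) • v),
        pow_ufv l q hq ui _ _ ((vvi'.symm.smul_left _).smul_right _), add_comm]
      · simp only [smul_pow, uip, vp, vip]
        simp only [smul_smul, ← sub_smul, ← add_smul, smul_mul_assoc, one_mul]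
        congr 2
        · simp [LclG, mul_pow, div_pow, inv_pow, -Complex.div_I]
          field_simp
        · simp [LclG, mul_pow, hhp, inv_pow]
          field_simp
      · rw [mul_smul_comm, uivi, smul_mul_assoc, smul_comm]
      · rw [mul_smul_comm, uiv, smul_mul_assoc, smul_comm]
    · simp only [smul_mul_assoc, mul_smul_comm, ← mul_assoc, viui]
      simp only [mul_add, smul_mul_assoc, mul_smul_comm, mul_assoc, vvi, viv, smul_add, add_mul]
      match_scalars <;> ring
    · simp only [smul_mul_assoc, mul_smul_comm, ← mul_assoc, vui]
      simp only [mul_add, smul_mul_assoc, mul_smul_comm, mul_assoc, vvi, viv, smul_add, add_mul]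
      match_scalars <;> ring

/-! ### The concrete operators -/

theorem Qp_add (l : ℕ) (q : ℂ) (hq : q ^ (2*l+1) = 1) (a b : ZMod (2*l+1)) :
    Qp l q (a + b) = Qp l q a * Qp l q b := by
  rw [Qp, Qp, Qp, ← pow_add, ZMod.val_add]
  exact (pow_eq_pow_mod _ hq).symm

theorem Qp_zero (l : ℕ) (q : ℂ) : Qp l q 0 = 1 := by simp [Qp]

theorem Qp_one (l : ℕ) (q : ℂ) (hl : 1 ≤ l) : Qp l q 1 = q := by
  have : Fact (1 < 2*l+1) := ⟨by omega⟩
  simp [Qp, ZMod.val_one]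

theorem Qp_neg (l : ℕ) (q : ℂ) (hq : q ^ (2*l+1) = 1) (a : ZMod (2*l+1)) :
    Qp l q (-a) = (Qp l q a)⁻¹ := by
  have h := Qp_add l q hq a (-a)
  rw [add_neg_cancel, Qp_zero] at h
  exact eq_inv_of_mul_eq_one_right h.symm

theorem Qp_pow (l : ℕ) (q : ℂ) (hq : q ^ (2*l+1) = 1) (a : ZMod (2*l+1)) :
    Qp l q a ^ (2*l+1) = 1 := by
  rw [Qp, ← pow_mul, mul_comm, pow_mul, hq, one_pow]

theorem Qp_ne_zero (l : ℕ) (q : ℂ) (hq : q ^ (2*l+1) = 1) (a : ZMod (2*l+1)) :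
    Qp l q a ≠ 0 := by
  intro h
  have := Qp_pow l q hq a
  simp [h] at this

/-- Generic weighted shift. -/
def shiftOp (l : ℕ) {N : ℕ} (n : Fin N) (a : ZMod (2*l+1)) (c : ℂ) :
    Matrix (Idx l N) (Idx l N) ℂ :=
  fun k k' => if k' = Function.update k n (k n + a) then c else 0

theorem vop_eq (l : ℕ) {N : ℕ} (v : Fin N → ℂ) (n : Fin N) :
    vop l v n = shiftOp l n (-1) (v n) := by
  ext k k'; simp [vop, shiftOp, sub_eq_add_neg]

theorem vopInv_eq (l : ℕ) {N : ℕ} (v : Fin N → ℂ) (n : Fin N) :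
    vopInv l v n = shiftOp l n 1 (v n)⁻¹ := by
  ext k k'; simp [vopInv, shiftOp]

theorem shiftOp_mul_apply (l : ℕ) {N : ℕ} (n : Fin N) (a : ZMod (2*l+1)) (c : ℂ)
    (X : Matrix (Idx l N) (Idx l N) ℂ) (k k' : Idx l N) :
    (shiftOp l n a c * X) k k' = c * X (Function.update k n (k n + a)) k' := by
  simp [Matrix.mul_apply, shiftOp]

theorem shiftOp_zero (l : ℕ) {N : ℕ} (n : Fin N) (c : ℂ) : shiftOp l n 0 c = c • 1 := by
  ext k k'
  simp [shiftOp, Matrix.one_apply, eq_comm]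

theorem shiftOp_mul (l : ℕ) {N : ℕ} (n : Fin N) (a b : ZMod (2*l+1)) (c d : ℂ) :
    shiftOp l n a c * shiftOp l n b d = shiftOp l n (a + b) (c * d) := by
  ext k k'
  rw [shiftOp_mul_apply]
  simp [shiftOp, add_assoc]

theorem shiftOp_pow (l : ℕ) {N : ℕ} (n : Fin N) (a : ZMod (2*l+1)) (c : ℂ) (m : ℕ) :
    shiftOp l n a c ^ m = shiftOp l n (m * a) (c ^ m) := by
  induction m with
  | zero => simp [shiftOp_zero]
  | succ m ih =>
    rw [pow_succ, ih, shiftOp_mul, pow_succ]; congr 1; push_cast; ring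

theorem shiftOp_pow_p (l : ℕ) {N : ℕ} (n : Fin N) (a : ZMod (2*l+1)) (c : ℂ) :
    shiftOp l n a c ^ (2*l+1) = c ^ (2*l+1) • 1 := by
  rw [shiftOp_pow, ZMod.natCast_self, zero_mul, shiftOp_zero]

theorem shiftOp_commute (l : ℕ) {N : ℕ} {n m : Fin N} (h : n ≠ m) (a b : ZMod (2*l+1)) (c d : ℂ) :
    Commute (shiftOp l n a c) (shiftOp l m b d) := by
  rw [Commute, SemiconjBy]
  ext k k'
  rw [shiftOp_mul_apply, shiftOp_mul_apply]
  simp only [shiftOp, Function.update_of_ne h, Function.update_of_ne h.symm,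
    Function.update_comm h]
  split_ifs <;> ring

theorem diag_commute_shiftOp (l : ℕ) {N : ℕ} {n m : Fin N} (h : n ≠ m)
    (f : ZMod (2*l+1) → ℂ) (b : ZMod (2*l+1)) (d : ℂ) :
    Commute (Matrix.diagonal fun k : Idx l N => f (k n)) (shiftOp l m b d) := by
  rw [Commute, SemiconjBy]
  ext k k'
  rw [shiftOp_mul_apply, Matrix.diagonal_mul]
  simp only [shiftOp, Matrix.diagonal_apply, Function.update_of_ne h, eq_comm (a := k')]
  split_ifs <;> ring

theorem diag_shiftOp (l : ℕ) {N : ℕ} (n : Fin N)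
    (f : ZMod (2*l+1) → ℂ) (b : ZMod (2*l+1)) (d r : ℂ) (hf : ∀ x, f x = r * f (x + b)) :
    (Matrix.diagonal fun k : Idx l N => f (k n)) * (shiftOp l n b d)
      = r • (shiftOp l n b d * Matrix.diagonal fun k : Idx l N => f (k n)) := by
  ext k k'
  rw [Matrix.smul_apply, shiftOp_mul_apply, Matrix.diagonal_mul, hf]
  simp only [shiftOp, Matrix.diagonal_apply, Function.update_self, eq_comm (a := k'), smul_eq_mul]
  split_ifs <;> ring

theorem site_concrete (l : ℕ) {N : ℕ} (hl : 1 ≤ l) (q : ℂ) (hq : IsPrimitiveRoot q (2*l+1))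
    (u v : Fin N → ℂ) (n : Fin N) (hu : u n ≠ 0) (hv : v n ≠ 0) :
    Site q (uop l q u n) (uopInv l q u n) (vop l v n) (vopInv l v n) := by
  have hp := hq.pow_eq_one
  have hq0 : q ≠ 0 := hq.ne_zero (by omega)
  have q1 := Qp_one l q hl
  rw [vop_eq, vopInv_eq]
  refine ⟨?_, ?_, ?_, ?_, ?_, ?_, ?_, ?_⟩
  · rw [shiftOp_mul]; simp [hv, shiftOp_zero]
  · rw [shiftOp_mul]; simp [hv, shiftOp_zero]
  · rw [uop, uopInv, Matrix.diagonal_mul_diagonal, ← Matrix.diagonal_one]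
    congr 1; ext k
    have := Qp_ne_zero l q hp (k n)
    rw [Qp_neg l q hp]; field_simp
  · rw [uop, uopInv, Matrix.diagonal_mul_diagonal, ← Matrix.diagonal_one]
    congr 1; ext k
    have := Qp_ne_zero l q hp (k n)
    rw [Qp_neg l q hp]; field_simp
  · refine diag_shiftOp l n (fun x => u n * Qp l q x) _ _ _ fun x => ?_
    simp only [Qp_add l q hp, Qp_neg l q hp, q1]; field_simp
  · refine diag_shiftOp l n (fun x => u n * Qp l q x) _ _ _ fun x => ?_
    simp only [Qp_add l q hp, q1]; field_simp
  · refine diag_shiftOp l n (fun x => (u n)⁻¹ * Qp l q (-x)) _ _ _ fun x => ?_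
    simp only [Qp_add l q hp, Qp_neg l q hp, q1, mul_inv, inv_inv]; field_simp
  · refine diag_shiftOp l n (fun x => (u n)⁻¹ * Qp l q (-x)) _ _ _ fun x => ?_
    simp only [Qp_add l q hp, Qp_neg l q hp, q1, mul_inv]; field_simp

theorem uop_pow_p (l : ℕ) {N : ℕ} (q : ℂ) (hp : q ^ (2*l+1) = 1) (u : Fin N → ℂ) (n : Fin N) :
    uop l q u n ^ (2*l+1) = (u n) ^ (2*l+1) • 1 := by
  rw [uop, Matrix.diagonal_pow, Matrix.smul_one_eq_diagonal]
  congr 1; ext k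
  simp [mul_pow, Qp_pow l q hp]

theorem uopInv_pow_p (l : ℕ) {N : ℕ} (q : ℂ) (hp : q ^ (2*l+1) = 1) (u : Fin N → ℂ)
    (n : Fin N) : uopInv l q u n ^ (2*l+1) = ((u n) ^ (2*l+1))⁻¹ • 1 := by
  rw [uopInv, Matrix.diagonal_pow, Matrix.smul_one_eq_diagonal]
  congr 1; ext k
  simp [mul_pow, Qp_pow l q hp]

/-- `T` commutes with all four generators of site `n`. -/
def CommSite (l : ℕ) {N : ℕ} (q : ℂ) (u v : Fin N → ℂ) (n : Fin N)
    (T : Matrix (Idx l N) (Idx l N) ℂ) : Prop :=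
  Commute T (uop l q u n) ∧ Commute T (uopInv l q u n) ∧ Commute T (vop l v n) ∧
    Commute T (vopInv l v n)

theorem Lax_eq (l : ℕ) {N : ℕ} (q : ℂ) (κ ξ u v : Fin N → ℂ) (lam : ℂ) (n : Fin N) :
    Lax l q κ ξ u v lam n = LaxG (q ^ (l+1)) (κ n) (ξ n) (uop l q u n) (uopInv l q u n)
      (vop l v n) (vopInv l v n) lam := rfl

theorem CommSite.lax {l N : ℕ} {q : ℂ} {u v : Fin N → ℂ} {n : Fin N}
    {T : Matrix (Idx l N) (Idx l N) ℂ} (h : CommSite l q u v n T) (κ ξ : Fin N → ℂ) (lam : ℂ)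
    (i j : Fin 2) : Commute T (Lax l q κ ξ u v lam n i j) := by
  obtain ⟨h1, h2, h3, h4⟩ := h
  have h00 : Commute T (Lax l q κ ξ u v lam n 0 0) := by
    rw [Lax_eq, LaxG00]
    exact (h1.mul_right ((h3.smul_right _).add_right (h4.smul_right _))).smul_right _
  have h01 : Commute T (Lax l q κ ξ u v lam n 0 1) := by
    rw [Lax_eq, LaxG01]
    exact ((h3.smul_right _).sub_right (h4.smul_right _)).smul_right _
  have h10 : Commute T (Lax l q κ ξ u v lam n 1 0) := by
    rw [Lax_eq, LaxG10]
    exact ((h4.smul_right _).sub_right (h3.smul_right _)).smul_right _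
  have h11 : Commute T (Lax l q κ ξ u v lam n 1 1) := by
    rw [Lax_eq, LaxG11]
    exact (h2.mul_right ((h3.smul_right _).add_right (h4.smul_right _))).smul_right _
  fin_cases i <;> fin_cases j
  · exact h00
  · exact h01
  · exact h10
  · exact h11

theorem commSite_gens (l : ℕ) {N : ℕ} (q : ℂ) (u v : Fin N → ℂ) {n m : Fin N} (h : n ≠ m) :
    CommSite l q u v n (uop l q u m) ∧ CommSite l q u v n (uopInv l q u m) ∧
    CommSite l q u v n (vop l v m) ∧ CommSite l q u v n (vopInv l v m) := by
  have dd : ∀ f g : Idx l N → ℂ, Commute (Matrix.diagonal f) (Matrix.diagonal g) :=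
    fun f g => Matrix.commute_diagonal f g
  have d1 : ∀ {a b : Fin N}, a ≠ b → ∀ x y, Commute (uop l q u a) (shiftOp l b x y) :=
    fun {a b} hab x y => diag_commute_shiftOp l hab (fun x => u a * Qp l q x) x y
  have d2 : ∀ {a b : Fin N}, a ≠ b → ∀ x y, Commute (uopInv l q u a) (shiftOp l b x y) :=
    fun {a b} hab x y => diag_commute_shiftOp l hab (fun x => (u a)⁻¹ * Qp l q (-x)) x y
  simp only [CommSite, vop_eq, vopInv_eq]
  refine ⟨⟨dd _ _, dd _ _, d1 h.symm _ _, d1 h.symm _ _⟩,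
    ⟨dd _ _, dd _ _, d2 h.symm _ _, d2 h.symm _ _⟩,
    ⟨(d1 h _ _).symm, (d2 h _ _).symm, shiftOp_commute l h.symm _ _ _ _,
      shiftOp_commute l h.symm _ _ _ _⟩,
    ⟨(d1 h _ _).symm, (d2 h _ _).symm, shiftOp_commute l h.symm _ _ _ _,
      shiftOp_commute l h.symm _ _ _ _⟩⟩

/-- Monodromy matrix over a list of sites. -/
def MonL (l : ℕ) {N : ℕ} (q : ℂ) (κ ξ u v : Fin N → ℂ) (lam : ℂ) (s : List (Fin N)) :
    Matrix (Fin 2) (Fin 2) (Matrix (Idx l N) (Idx l N) ℂ) :=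
  (s.map fun n => Lax l q κ ξ u v lam n).prod

theorem MonL_commute (l : ℕ) {N : ℕ} (q : ℂ) (κ ξ u v : Fin N → ℂ) (lam : ℂ) (s : List (Fin N))
    (T : Matrix (Idx l N) (Idx l N) ℂ) (hT : ∀ m ∈ s, CommSite l q u v m T) :
    ∀ i j, Commute T (MonL l q κ ξ u v lam s i j) := by
  induction s with
  | nil =>
    intro i j
    simp only [MonL, List.map_nil, List.prod_nil, Matrix.one_apply]
    split_ifs
    · exact Commute.one_right _
    · exact Commute.zero_right _
  | cons n s ih =>
    intro i j
    have ih' := ih (fun m hm => hT m (List.mem_cons_of_mem _ hm))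
    have hn := hT n List.mem_cons_self
    have e : MonL l q κ ξ u v lam (n :: s) = Lax l q κ ξ u v lam n * MonL l q κ ξ u v lam s := by
      simp [MonL]
    rw [e, Matrix.mul_apply, Fin.sum_univ_two]
    exact ((hn.lax _ _ _ _ _).mul_right (ih' _ _)).add_right
      ((hn.lax _ _ _ _ _).mul_right (ih' _ _))

theorem Lcl_eq (l : ℕ) {N : ℕ} (κ ξ u v : Fin N → ℂ) (L : ℂ) (n : Fin N) :
    Lcl l κ ξ u v L n = LclG l (κ n) (ξ n) (u n) (v n) L := rfl

theorem avg_list (l N : ℕ) (hl : 1 ≤ l)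
    (q : ℂ) (hq : IsPrimitiveRoot q (2*l+1))
    (κ ξ u v : Fin N → ℂ) (hκ : ∀ n, κ n ≠ 0) (hξ : ∀ n, ξ n ≠ 0)
    (hu : ∀ n, u n ≠ 0) (hv : ∀ n, v n ≠ 0)
    (lam : ℂ) (hlam : lam ≠ 0) (s : List (Fin N)) (hs : s.Nodup) :
    (∀ mu : ℂ, mu ≠ 0 → YBRel (MonL l q κ ξ u v mu s) (MonL l q κ ξ u v (q * mu) s)) ∧
    ∀ i j : Fin 2, oprod (fun k => MonL l q κ ξ u v (q ^ (k+1) * lam) s i j) (2*l+1)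
      = ((s.map fun n => Lcl l κ ξ u v (lam ^ (2*l+1)) n).prod i j) •
        (1 : Matrix (Idx l N) (Idx l N) ℂ) := by
  have hq0 : q ≠ 0 := hq.ne_zero (by omega)
  induction s with
  | nil =>
    refine ⟨fun mu _ => ?_, fun i j => ?_⟩
    · simpa [MonL] using YBRel_one
    · simp only [MonL, List.map_nil, List.prod_nil, oprod_const, Matrix.one_apply]
      by_cases h : i = j <;> simp [h]
  | cons n s ih =>
    obtain ⟨hn, hs'⟩ := List.nodup_cons.mp hs
    obtain ⟨ih1, ih2⟩ := ih hs'
    have e : ∀ mu, MonL l q κ ξ u v mu (n :: s)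
        = Lax l q κ ξ u v mu n * MonL l q κ ξ u v mu s := by
      intro mu; simp [MonL]
    have S := site_concrete l hl q hq u v n (hu n) (hv n)
    have hg : ∀ m ∈ s, _ := fun m hm => commSite_gens l q u v (n := m) (m := n)
      (fun h => hn (h ▸ hm))
    have c1 := fun mu => MonL_commute l q κ ξ u v mu s (uop l q u n) (fun m hm => (hg m hm).1)
    have c2 := fun mu => MonL_commute l q κ ξ u v mu s (uopInv l q u n)
      (fun m hm => (hg m hm).2.1)
    have c3 := fun mu => MonL_commute l q κ ξ u v mu s (vop l v n) (fun m hm => (hg m hm).2.2.1)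
    have c4 := fun mu => MonL_commute l q κ ξ u v mu s (vopInv l v n)
      (fun m hm => (hg m hm).2.2.2)
    have hh : (q ^ (l+1)) ^ 2 = q := by
      rw [← pow_mul, show (l+1)*2 = (2*l+1)+1 by ring, pow_succ, hq.pow_eq_one, one_mul]
    refine ⟨fun mu hmu => ?_, fun i j => ?_⟩
    · rw [e, e]
      refine YBRel_mul ?_ (ih1 mu hmu) ?_
      · rw [Lax_eq, Lax_eq]
        exact YBRel_LaxG mu S hh (pow_ne_zero _ hq0) (hκ n) (hξ n) hmu
      · intro i j i' j'
        exact CommSite.lax ⟨(c1 mu i j).symm, (c2 mu i j).symm, (c3 mu i j).symm,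
          (c4 mu i j).symm⟩ _ _ _ _ _
    · simp only [e, Lax_eq]
      rw [avg_step l (u n) (v n) lam hq S (hκ n) (hξ n) hlam (hu n) (hv n)
        (uop_pow_p l q hq.pow_eq_one u n) (uopInv_pow_p l q hq.pow_eq_one u n)
        (by rw [vop_eq, shiftOp_pow_p]) (by rw [vopInv_eq, shiftOp_pow_p, inv_pow])
        (fun k => MonL l q κ ξ u v (q ^ (k+1) * lam) s) ?_ (fun k => c1 _) (fun k => c2 _)
        (fun k => c3 _) (fun k => c4 _) i j, ih2, ih2]
      · rw [List.map_cons, List.prod_cons, Matrix.mul_apply, Fin.sum_univ_two, Lcl_eq, add_smul,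
          smul_smul, smul_smul]
      · intro k
        have := ih1 (q ^ (k+1) * lam) (mul_ne_zero (pow_ne_zero _ hq0) hlam)
        rwa [← mul_assoc, ← pow_succ'] at this

/-- **Average values are central and factorize** (Propositions 4.1, 4.2): each average
`𝒪(Λ) = ∏_{k=1}^p O(q^k λ)`, `O ∈ {A,B,C,D}`, is a scalar multiple of the identity, and
the 2×2 scalar matrix of these averages equals `𝓛_N(Λ)·𝓛_{N-1}(Λ)···𝓛_1(Λ)`, `Λ = λ^p`. -/
theorem average_values_central_and_factorize (l N : ℕ) (hl : 1 ≤ l)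
    (q : ℂ) (hq : IsPrimitiveRoot q (2*l+1))
    (κ ξ u v : Fin N → ℂ) (hκ : ∀ n, κ n ≠ 0) (hξ : ∀ n, ξ n ≠ 0)
    (hu : ∀ n, u n ≠ 0) (hv : ∀ n, v n ≠ 0)
    (lam : ℂ) (hlam : lam ≠ 0) :
    ∃ c : Matrix (Fin 2) (Fin 2) ℂ,
      (∀ i j : Fin 2, avgEntry l q κ ξ u v i j lam
          = c i j • (1 : Matrix (Idx l N) (Idx l N) ℂ)) ∧
        c = LclProd l κ ξ u v (lam ^ (2*l+1)) := by
  refine ⟨LclProd l κ ξ u v (lam ^ (2*l+1)), fun i j => ?_, rfl⟩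
  have h := (avg_list l N hl q hq κ ξ u v hκ hξ hu hv lam hlam (List.finRange N).reverse
    (List.nodup_reverse.mpr (List.nodup_finRange N))).2 i j
  rw [← ofFn_prod_eq_oprod] at h
  simp only [MonL, List.map_reverse, ← List.ofFn_eq_map] at h
  exact h
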